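/- Let q > 4 be a prime power and let C be a formally self-dual linear code of length 2n over F_q that is divisible by some integer Δ > 1 (i.e., Δ divides the weight of every codeword). Then C is monomially equivalent to the direct sum of n copies of the code ⟨(1,1)⟩ ⊆ F_q^2 spanned by (1,1). -/

import Mathlib

open Finset

noncomputable def homWeightEnum (R : Type*) [CommRing R] {F : Type*} [Field F] [Fintype F]
    [DecidableEq F] {ι : Type*} [Fintype ι] (C : Submodule F (ι → F)) : MvPolynomial (Fin 2) R :=
  ∑ c ∈ (Set.toFinite (C : Set (ι → F))).toFinset,
    MvPolynomial.X 0 ^ (Fintype.card ι - hammingNorm c) * MvPolynomial.X 1 ^ hammingNorm c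

noncomputable def matAct (A : Matrix (Fin 2) (Fin 2) ℂ) (p : MvPolynomial (Fin 2) ℂ) :
    MvPolynomial (Fin 2) ℂ :=
  MvPolynomial.aeval
    (fun i => MvPolynomial.C (A i 0) * MvPolynomial.X 0 + MvPolynomial.C (A i 1) * MvPolynomial.X 1) p

def MonomialEquiv {F : Type*} [Field F] {ι : Type*} (C D : Submodule F (ι → F)) : Prop :=
  ∃ (d : ι → Fˣ) (π : Equiv.Perm ι),
    (D : Set (ι → F)) = (fun v => fun i => (d i : F) * v (π i)) '' (C : Set (ι → F))

def pairCode (F : Type*) [Field F] (n : ℕ) : Submodule F (Fin n → F) where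
  carrier := {v | ∀ (j : ℕ) (h1 : 2*j < n) (h2 : 2*j+1 < n), v ⟨2*j, h1⟩ = v ⟨2*j+1, h2⟩}
  add_mem' := by
    intro a b ha hb j h1 h2
    simp only [Pi.add_apply, ha j h1 h2, hb j h1 h2]
  zero_mem' := by intro j h1 h2; rfl
  smul_mem' := by
    intro c v hv j h1 h2
    simp only [Pi.smul_apply, hv j h1 h2]


def cr (u v : Fin 2 → ℂ) : ℂ := u 0 * v 1 - u 1 * v 0

lemma integral_of_pow_scalar (M : Matrix (Fin 2) (Fin 2) ℂ) (hdet : M.det ≠ 0) (k : ℕ)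
    (hk : 0 < k) (s : ℂ) (h : M ^ k = s • 1) : IsIntegral ℤ (M.trace ^ 2 / M.det) := by
  have key : ∀ l : ℂ, l ^ 2 - M.trace * l + M.det = 0 → l ^ k = s := by
    intro l hl
    have hd : (M - l • (1 : Matrix (Fin 2) (Fin 2) ℂ)).det = 0 := by
      rw [← hl]
      simp [Matrix.det_fin_two, Matrix.trace_fin_two]
      ring
    obtain ⟨v, hv, hMv⟩ := Matrix.exists_mulVec_eq_zero_iff.mpr hd
    have hMv' : M.mulVec v = l • v := by
      rw [Matrix.sub_mulVec, Matrix.smul_mulVec, Matrix.one_mulVec] at hMv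
      exact sub_eq_zero.mp hMv
    have hp : ∀ j : ℕ, (M ^ j).mulVec v = l ^ j • v := by
      intro j
      induction j with
      | zero => simp
      | succ j ih =>
        rw [pow_succ, ← Matrix.mulVec_mulVec, hMv', Matrix.mulVec_smul, ih, smul_smul, pow_succ,
          mul_comm]
    have := hp k
    rw [h, Matrix.smul_mulVec, Matrix.one_mulVec] at this
    exact (smul_left_injective ℂ hv this).symm
  obtain ⟨r, hr⟩ := IsAlgClosed.exists_pow_nat_eq (M.trace ^ 2 - 4 * M.det) (n := 2) (by norm_num)
  set l := (M.trace + r) / 2 with hl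
  set m := (M.trace - r) / 2 with hm
  have hsum : l + m = M.trace := by rw [hl, hm]; ring
  have hprod : l * m = M.det := by rw [hl, hm]; linear_combination (-1/4) * hr
  have h1 : l ^ k = s := key l (by rw [← hsum, ← hprod]; ring)
  have h2 : m ^ k = s := key m (by rw [← hsum, ← hprod]; ring)
  have hl0 : l ≠ 0 := by rintro h; apply hdet; rw [← hprod, h, zero_mul]
  have hm0 : m ≠ 0 := by rintro h; apply hdet; rw [← hprod, h, mul_zero]
  have int1 : ∀ a b : ℂ, b ≠ 0 → a ^ k = s → b ^ k = s → IsIntegral ℤ (a / b) := by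
    intro a b hb ha hb'
    apply IsIntegral.of_pow hk
    rw [div_pow, ha, ← hb', div_self (pow_ne_zero _ hb)]
    exact isIntegral_one
  have : M.trace ^ 2 / M.det = l / m + m / l + (2 : ℤ) := by
    rw [← hsum, ← hprod]; push_cast; field_simp; ring
  rw [this]
  exact ((int1 _ _ hm0 h1 h2).add (int1 _ _ hl0 h2 h1)).add isIntegral_algebraMap

lemma scalar_of_three (N : Matrix (Fin 2) (Fin 2) ℂ) (u v w : Fin 2 → ℂ)
    (huv : cr u v ≠ 0) (huw : cr u w ≠ 0) (hvw : cr v w ≠ 0) (a b c : ℂ)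
    (hu : N.mulVec u = a • u) (hv : N.mulVec v = b • v) (hw : N.mulVec w = c • w) :
    N = a • 1 := by
  have u0 := congrFun hu 0
  have u1 := congrFun hu 1
  have v0 := congrFun hv 0
  have v1 := congrFun hv 1
  have w0 := congrFun hw 0
  have w1 := congrFun hw 1
  simp only [Matrix.mulVec, dotProduct, Fin.sum_univ_two, Pi.smul_apply, smul_eq_mul] at u0 u1 v0 v1 w0 w1
  unfold cr at huv huw hvw
  have e : ∀ a b : ℂ, a ≠ 0 → a * b = 0 → b = 0 := fun a b h h' => (mul_eq_zero.mp h').resolve_left h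
  have hab : a - b = 0 := by
    have t1 : ∀ (p q : Fin 2 → ℂ) (s t : ℂ), cr p q ≠ 0 → 
        N.mulVec p = s • p → N.mulVec q = t • q → s + t = N 0 0 + N 1 1 := by
      intro p q s t hpq hp hq
      have p0 := congrFun hp 0
      have p1 := congrFun hp 1
      have q0 := congrFun hq 0
      have q1 := congrFun hq 1
      simp only [Matrix.mulVec, dotProduct, Fin.sum_univ_two, Pi.smul_apply, smul_eq_mul] at p0 p1 q0 q1
      unfold cr at hpq
      have := e _ (s + t - (N 0 0 + N 1 1)) hpq (by
        linear_combination (-q 1) * p0 + q 0 * p1 + p 1 * q0 - p 0 * q1)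
      linear_combination this
    have e1 := t1 u w a c huw hu hw
    have e2 := t1 v w b c hvw hv hw
    linear_combination e1 - e2
  have hab' : b = a := by linear_combination -hab
  subst hab'
  ext i j
  fin_cases i <;> fin_cases j <;> simp
  · have := e _ (N 0 0 - b) huv (by linear_combination v 1 * u0 - u 1 * v0)
    linear_combination this
  · exact e _ (N 0 1) huv (by linear_combination -v 0 * u0 + u 0 * v0)
  · exact e _ (N 1 0) huv (by linear_combination v 1 * u1 - u 1 * v1)
  · have := e _ (N 1 1 - b) huv (by linear_combination -v 0 * u1 + u 0 * v1)
    linear_combination this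

lemma exists_pow_eigen (M : Matrix (Fin 2) (Fin 2) ℂ) (hdet : M.det ≠ 0)
    (Z : Set (Fin 2 → ℂ)) (hZ : ∀ v ∈ Z, M.mulVec v ∈ Z)
    (hfin : ((fun v : Fin 2 → ℂ => v 1 / v 0) '' Z).Finite)
    (hpar : ∀ u ∈ Z, ∀ v ∈ Z, u 1 / u 0 = v 1 / v 0 → ∃ s : ℂ, v = s • u)
    (v : Fin 2 → ℂ) (hv : v ∈ Z) : ∃ k : ℕ, 0 < k ∧ ∃ s : ℂ, (M ^ k).mulVec v = s • v := by
  have hmem : ∀ j : ℕ, (M ^ j).mulVec v ∈ Z := by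
    intro j
    induction j with
    | zero => simpa using hv
    | succ j ih =>
      rw [pow_succ', ← Matrix.mulVec_mulVec]
      exact hZ _ ih
  obtain ⟨i, -, j, -, hij, he⟩ := Set.infinite_univ.exists_ne_map_eq_of_mapsTo
    (f := fun j : ℕ => ((M ^ j).mulVec v) 1 / ((M ^ j).mulVec v) 0)
    (fun j _ => Set.mem_image_of_mem _ (hmem j)) hfin
  have main : ∀ i j : ℕ, i < j → ((M ^ i).mulVec v) 1 / ((M ^ i).mulVec v) 0 =
      ((M ^ j).mulVec v) 1 / ((M ^ j).mulVec v) 0 →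
      ∃ k : ℕ, 0 < k ∧ ∃ s : ℂ, (M ^ k).mulVec v = s • v := by
    intro i j hij he
    obtain ⟨s, hs⟩ := hpar _ (hmem i) _ (hmem j) he
    refine ⟨j - i, by omega, s, ?_⟩
    have hinj : Function.Injective (M ^ i).mulVec := by
      apply Matrix.mulVec_injective_of_isUnit
      rw [Matrix.isUnit_iff_isUnit_det, Matrix.det_pow]
      exact (isUnit_iff_ne_zero.mpr hdet).pow _
    apply hinj
    rw [Matrix.mulVec_mulVec, ← pow_add, Matrix.mulVec_smul, ← hs]
    congr 2
    omega
  rcases lt_or_gt_of_ne hij with h | h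
  · exact main i j h he
  · exact main j i h he.symm

lemma eigen_pow_mul (M : Matrix (Fin 2) (Fin 2) ℂ) (v : Fin 2 → ℂ) (k : ℕ) (s : ℂ)
    (h : (M ^ k).mulVec v = s • v) (l : ℕ) : (M ^ (k * l)).mulVec v = s ^ l • v := by
  induction l with
  | zero => simp
  | succ l ih =>
    rw [Nat.mul_succ, pow_add, ← Matrix.mulVec_mulVec, h, Matrix.mulVec_smul, ih, smul_smul,
      pow_succ, mul_comm]

lemma integral_of_three_zeros (M : Matrix (Fin 2) (Fin 2) ℂ) (hdet : M.det ≠ 0)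
    (Z : Set (Fin 2 → ℂ)) (hZ : ∀ v ∈ Z, M.mulVec v ∈ Z)
    (hfin : ((fun v : Fin 2 → ℂ => v 1 / v 0) '' Z).Finite)
    (hpar : ∀ u ∈ Z, ∀ v ∈ Z, u 1 / u 0 = v 1 / v 0 → ∃ s : ℂ, v = s • u)
    (u v w : Fin 2 → ℂ) (hu : u ∈ Z) (hv : v ∈ Z) (hw : w ∈ Z)
    (huv : cr u v ≠ 0) (huw : cr u w ≠ 0) (hvw : cr v w ≠ 0) :
    IsIntegral ℤ (M.trace ^ 2 / M.det) := by
  obtain ⟨k1, hk1, s1, h1⟩ := exists_pow_eigen M hdet Z hZ hfin hpar u hu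
  obtain ⟨k2, hk2, s2, h2⟩ := exists_pow_eigen M hdet Z hZ hfin hpar v hv
  obtain ⟨k3, hk3, s3, h3⟩ := exists_pow_eigen M hdet Z hZ hfin hpar w hw
  have e1 := eigen_pow_mul M u k1 s1 h1 (k2 * k3)
  have e2 := eigen_pow_mul M v k2 s2 h2 (k1 * k3)
  have e3 := eigen_pow_mul M w k3 s3 h3 (k1 * k2)
  rw [show k2 * (k1 * k3) = k1 * (k2 * k3) by ring] at e2
  rw [show k3 * (k1 * k2) = k1 * (k2 * k3) by ring] at e3
  exact integral_of_pow_scalar M hdet _ (by positivity) _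
    (scalar_of_three _ u v w huv huw hvw _ _ _ e1 e2 e3)

lemma not_all_integral (q D : ℕ) (hq : 4 < q) (hD : 1 < D) (ζ : ℂ) (hζ : IsPrimitiveRoot ζ D)
    (h : ∀ i, 0 < i → i < D → IsIntegral ℤ ((1 - ζ ^ i) ^ 2 / (q : ℂ))) : False := by
  obtain ⟨m, rfl⟩ : ∃ m, D = m + 1 := ⟨D - 1, by omega⟩
  have hp := hζ.prod_one_sub_pow_eq_order
  have hint : IsIntegral ℤ (∏ i ∈ range m, ((1 - ζ ^ (i + 1)) ^ 2 / (q : ℂ))) := by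
    apply IsIntegral.prod
    intro i hi
    exact h _ (by omega) (by have := mem_range.mp hi; omega)
  rw [prod_div_distrib, prod_pow, hp, prod_const, card_range] at hint
  have hq0 : (q : ℂ) ≠ 0 := by
    have : q ≠ 0 := by omega
    exact_mod_cast this
  have h2 : IsIntegral ℤ (algebraMap ℚ ℂ (((m : ℚ) + 1) ^ 2 / (q : ℚ) ^ m)) := by
    simpa using hint
  rw [isIntegral_algebraMap_iff (algebraMap ℚ ℂ).injective] at h2
  obtain ⟨z, hz⟩ := IsIntegrallyClosed.isIntegral_iff.mp h2
  have hq0' : (q : ℚ) ^ m ≠ 0 := by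
    have : q ≠ 0 := by omega
    positivity
  rw [eq_div_iff hq0'] at hz
  have hz' : z * (q : ℤ) ^ m = ((m : ℤ) + 1) ^ 2 := by
    have : ((z * (q : ℤ) ^ m : ℤ) : ℚ) = (((m : ℤ) + 1) ^ 2 : ℤ) := by
      push_cast; simpa using hz
    exact_mod_cast this
  have hdvd : q ^ m ∣ (m + 1) ^ 2 := by
    have : ((q ^ m : ℕ) : ℤ) ∣ ((m + 1) ^ 2 : ℕ) := ⟨z, by push_cast; rw [← hz']; ring⟩
    exact_mod_cast this
  have hle := Nat.le_of_dvd (by positivity) hdvd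
  have h5 : 5 ^ m ≤ q ^ m := Nat.pow_le_pow_left hq m
  have hlt : ∀ m : ℕ, 1 ≤ m → (m + 1) ^ 2 < 5 ^ m := by
    intro m hm
    induction m, hm using Nat.le_induction with
    | base => norm_num
    | succ m hm ih => rw [pow_succ 5]; nlinarith
  have := hlt m (by omega)
  omega

lemma two_zero_lines {n : ℕ} (q K : ℂ) (hK : K ≠ 0) (hq0 : q ≠ 0) (f : ℂ → ℂ → ℂ)
    (P : Polynomial ℂ) (hP : ∀ y, P.eval y = f 1 y)
    (hhom : ∀ s x y, f (s * x) (s * y) = s ^ (2 * n) * f x y)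
    (h10 : f 1 0 = 1) (ζ : ℂ) (hζ0 : ζ ≠ 0)
    (hζ : ∀ x y, f x (ζ * y) = f x y)
    (hf : ∀ x y, f (x + (q - 1) * y) (x - y) = K * f x y)
    (u v w : Fin 2 → ℂ) (hu : f (u 0) (u 1) = 0) (hv : f (v 0) (v 1) = 0)
    (hw : f (w 0) (w 1) = 0)
    (huv : cr u v ≠ 0) (huw : cr u w ≠ 0) (hvw : cr v w ≠ 0) :
    IsIntegral ℤ ((1 - ζ) ^ 2 / (-q * ζ)) := by
  set M : Matrix (Fin 2) (Fin 2) ℂ := !![1, (q - 1) * ζ; 1, -ζ] with hM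
  have hdet : M.det = -q * ζ := by rw [hM, Matrix.det_fin_two_of]; ring
  have htr : M.trace = 1 - ζ := by rw [hM, Matrix.trace_fin_two_of]; ring
  have hdet0 : M.det ≠ 0 := by rw [hdet]; exact mul_ne_zero (neg_ne_zero.mpr hq0) hζ0
  rw [← hdet, ← htr]
  have hx0 : ∀ x, f x 0 = x ^ (2 * n) := by
    intro x
    have := hhom x 1 0
    rwa [mul_one, mul_zero, h10, mul_one] at this
  have hz1 : ∀ v : Fin 2 → ℂ, v ≠ 0 → f (v 0) (v 1) = 0 → v 1 ≠ 0 := by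
    intro v hv hfv h1
    rw [h1, hx0] at hfv
    apply hv
    ext i
    fin_cases i
    · by_contra h
      exact pow_ne_zero _ h hfv
    · exact h1
  have hne : ∀ a b : Fin 2 → ℂ, cr a b ≠ 0 → a ≠ 0 ∧ b ≠ 0 := by
    intro a b hab
    constructor <;> rintro rfl <;> simp [cr] at hab
  apply integral_of_three_zeros M hdet0 {v | v ≠ 0 ∧ f (v 0) (v 1) = 0} ?_ ?_ ?_ u v w
    ⟨(hne _ _ huv).1, hu⟩ ⟨(hne _ _ huv).2, hv⟩ ⟨(hne _ _ hvw).2, hw⟩ huv huw hvw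
  · rintro v ⟨hv0, hv⟩
    refine ⟨?_, ?_⟩
    · intro h
      apply hdet0
      exact Matrix.exists_mulVec_eq_zero_iff.mp ⟨v, hv0, h⟩
    · have e0 : M.mulVec v 0 = v 0 + (q - 1) * (ζ * v 1) := by
        simp [hM, Matrix.mulVec, dotProduct, Fin.sum_univ_two]; ring
      have e1 : M.mulVec v 1 = v 0 - ζ * v 1 := by
        simp [hM, Matrix.mulVec, dotProduct, Fin.sum_univ_two]; ring
      rw [e0, e1, hf, hζ, hv, mul_zero]
  · have hP0 : P ≠ 0 := by
      rintro rfl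
      have := hP 0
      rw [h10] at this
      simp at this
    apply ((P.roots.toFinset.finite_toSet).insert 0).subset
    rintro _ ⟨v, ⟨hv0, hv⟩, rfl⟩
    by_cases h0 : v 0 = 0
    · simp [h0]
    · right
      simp only [Finset.mem_coe, Multiset.mem_toFinset, Polynomial.mem_roots hP0, Polynomial.IsRoot,
        hP]
      have := hhom (v 0) 1 (v 1 / v 0)
      rw [mul_one, mul_div_cancel₀ _ h0, hv] at this
      exact (mul_eq_zero.mp this.symm).resolve_left (pow_ne_zero _ h0)
  · rintro a ⟨ha0, ha⟩ b ⟨hb0, hb⟩ hab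
    have ha1 := hz1 a ha0 ha
    have hb1 := hz1 b hb0 hb
    refine ⟨b 1 / a 1, ?_⟩
    ext i
    fin_cases i
    · simp
      by_cases h0 : a 0 = 0
      · rw [h0, div_zero] at hab
        have := (div_eq_zero_iff.mp hab.symm).resolve_left hb1
        rw [h0, this, mul_zero]
      · have hb0' : b 0 ≠ 0 := by
          intro h
          rw [h, div_zero] at hab
          exact (div_ne_zero ha1 h0) hab
        field_simp at hab ⊢
        linear_combination hab
    · simp; field_simp

lemma weight_two_count {α : Type*} (S : Finset α) (wt : α → ℕ) (n q D : ℕ) (hn : 0 < n)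
    (hq : 4 < q) (hD : 1 < D) (hle : ∀ c ∈ S, wt c ≤ 2 * n) (hdvd : ∀ c ∈ S, D ∣ wt c)
    (hone : ∑ c ∈ S, (1 : ℂ) ^ (2 * n - wt c) * 0 ^ wt c = 1)
    (hf : ∀ x y : ℂ, ∑ c ∈ S, (x + ((q : ℂ) - 1) * y) ^ (2 * n - wt c) * (x - y) ^ wt c =
      (S.card : ℂ) * ∑ c ∈ S, x ^ (2 * n - wt c) * y ^ wt c) :
    S.card = q ^ n ∧ (∀ c ∈ S, Even (wt c)) ∧ {c ∈ S | wt c = 2}.card = n * (q - 1) := by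
  set f : ℂ → ℂ → ℂ := fun x y => ∑ c ∈ S, x ^ (2 * n - wt c) * y ^ wt c with hfdef
  have h10 : f 1 0 = 1 := hone
  have hf' : ∀ x y, f (x + ((q : ℂ) - 1) * y) (x - y) = (S.card : ℂ) * f x y := hf
  have h11 : f 1 1 = (S.card : ℂ) := by simp [hfdef]
  have hhom : ∀ s x y, f (s * x) (s * y) = s ^ (2 * n) * f x y := by
    intro s x y
    simp only [hfdef, mul_sum]
    apply sum_congr rfl
    intro c hc
    have : s ^ (2 * n) = s ^ (2 * n - wt c) * s ^ wt c := by
      rw [← pow_add, Nat.sub_add_cancel (hle c hc)]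
    rw [mul_pow, mul_pow, this]; ring
  have hqC : (q : ℂ) ≠ 0 := by exact_mod_cast (by omega : q ≠ 0)
  have hcard : S.card = q ^ n := by
    have h1 := hf' 1 1
    rw [h11] at h1
    have h2 := hhom q 1 0
    rw [h10] at h2
    have e : (1 : ℂ) + ((q : ℂ) - 1) * 1 = q * 1 := by ring
    have e' : (1 : ℂ) - 1 = q * 0 := by ring
    rw [e, e', h2] at h1
    have h3 : q ^ (2 * n) = S.card * S.card := by
      have : ((q ^ (2 * n) : ℕ) : ℂ) = ((S.card * S.card : ℕ) : ℂ) := by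
        push_cast; linear_combination h1
      exact_mod_cast this
    have h4 : (q ^ n) ^ 2 = S.card ^ 2 := by rw [← pow_mul, mul_comm n 2, h3]; ring
    exact (Nat.pow_left_injective (n := 2) (by norm_num) h4).symm
  have hKgt : 1 < S.card := by rw [hcard]; exact Nat.one_lt_pow (by omega) (by omega)
  have hK0 : (S.card : ℂ) ≠ 0 := by exact_mod_cast (by omega : S.card ≠ 0)
  set P : Polynomial ℂ := ∑ c ∈ S, Polynomial.X ^ wt c with hPdef
  have hP : ∀ y, P.eval y = f 1 y := by
    intro y; simp [hPdef, hfdef, Polynomial.eval_finsetSum]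
  have hζ : ∀ ζ : ℂ, ζ ^ D = 1 → ∀ x y, f x (ζ * y) = f x y := by
    intro ζ hz x y
    simp only [hfdef]
    apply sum_congr rfl
    intro c hc
    obtain ⟨k, hk⟩ := hdvd c hc
    rw [mul_pow, hk, pow_mul ζ, hz, one_pow, one_mul]
  have hprim := Complex.isPrimitiveRoot_exp D (by omega)
  set ζ := Complex.exp (2 * Real.pi * Complex.I / D) with hζdef
  -- at most two zero lines
  have two : ∀ u v w : Fin 2 → ℂ, f (u 0) (u 1) = 0 → f (v 0) (v 1) = 0 → f (w 0) (w 1) = 0 →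
      cr u v ≠ 0 → cr u w ≠ 0 → cr v w ≠ 0 → False := by
    intro u v w hu hv hw huv huw hvw
    apply not_all_integral q D hq hD ζ hprim
    intro i hi hiD
    have hz : (ζ ^ i) ^ D = 1 := by rw [← pow_mul, mul_comm, pow_mul, hprim.pow_eq_one, one_pow]
    have hz0 : ζ ^ i ≠ 0 := by
      intro h; rw [h, zero_pow (by omega)] at hz; exact zero_ne_one hz
    have h1 := two_zero_lines (n := n) q S.card hK0 hqC f P hP hhom h10 (ζ ^ i) hz0 (hζ _ hz) hf'
      u v w hu hv hw huv huw hvw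
    have h2 : IsIntegral ℤ (ζ ^ i) := by
      apply IsIntegral.of_pow (n := D) (by omega)
      rw [hz]; exact isIntegral_one
    have := (h2.mul h1).neg
    have e : (1 - ζ ^ i) ^ 2 / (q : ℂ) = -(ζ ^ i * ((1 - ζ ^ i) ^ 2 / (-(q : ℂ) * ζ ^ i))) := by
      generalize ζ ^ i = t at hz0
      field_simp
    rw [e]
    exact this
  -- a zero exists
  obtain ⟨y0, hy0⟩ : ∃ y, f 1 y = 0 := by
    by_contra hno
    push Not at hno
    have hdeg : P.degree = 0 := by
      by_contra hd
      obtain ⟨r, hr⟩ := IsAlgClosed.exists_root P hd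
      exact hno r (by rw [← hP]; exact hr)
    rw [Polynomial.eq_C_of_degree_eq_zero hdeg] at hP
    have a := hP 0
    have b := hP 1
    rw [Polynomial.eval_C] at a b
    rw [a, h10, h11] at b
    have : S.card = 1 := by exact_mod_cast b.symm
    omega
  have hy00 : y0 ≠ 0 := by rintro rfl; rw [h10] at hy0; exact one_ne_zero hy0
  have hD2 : D = 2 := by
    by_contra hne
    have hz := hprim.pow_eq_one
    have hz1 : ζ ≠ 1 := hprim.ne_one hD
    have hz0 : ζ ≠ 0 := hprim.ne_zero (by omega)
    have hz2 : ζ ^ 2 ≠ 1 := by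
      intro h
      have := Nat.le_of_dvd (by norm_num) (hprim.dvd_of_pow_eq_one 2 h)
      omega
    apply two ![1, y0] ![1, ζ * y0] ![1, ζ * (ζ * y0)]
    · simpa using hy0
    · simpa [hζ ζ hz] using hy0
    · simpa [hζ ζ hz] using hy0
    · simp only [cr]
      have : y0 * (ζ - 1) ≠ 0 := mul_ne_zero hy00 (sub_ne_zero.mpr hz1)
      intro h; apply this; simp at h; linear_combination h
    · simp only [cr]
      have : y0 * (ζ ^ 2 - 1) ≠ 0 := mul_ne_zero hy00 (sub_ne_zero.mpr hz2)
      intro h; apply this; simp at h; linear_combination h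
    · simp only [cr]
      have : ζ * y0 * (ζ - 1) ≠ 0 := mul_ne_zero (mul_ne_zero hz0 hy00) (sub_ne_zero.mpr hz1)
      intro h; apply this; simp at h; linear_combination h
  subst hD2
  have heven : ∀ x y, f x (-y) = f x y := by
    intro x y
    have := hζ (-1) (by norm_num) x y
    rwa [neg_one_mul] at this
  have lines : ∀ y, f 1 y = 0 → ∀ a b : ℂ, f a b = 0 → b ^ 2 = y ^ 2 * a ^ 2 := by
    intro y hy a b hab
    have hy' : y ≠ 0 := by rintro rfl; rw [h10] at hy; exact one_ne_zero hy
    by_contra hne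
    apply two ![1, y] ![1, -y] ![a, b]
    · simpa using hy
    · simpa [heven] using hy
    · simpa using hab
    · simp only [cr]
      intro h; simp at h
      exact hy' (by linear_combination (-1/2) * h)
    · simp only [cr]
      intro h; simp at h
      exact hne (by linear_combination (b + y * a) * h)
    · simp only [cr]
      intro h; simp at h
      exact hne (by linear_combination (b - y * a) * h)
  have hq1 : (q : ℂ) - 1 ≠ 0 := by
    intro h
    have : (q : ℂ) = (1 : ℕ) := by push_cast; linear_combination h
    have : q = 1 := by exact_mod_cast this
    omega
  have roots : ∀ y, f 1 y = 0 → ((q : ℂ) - 1) * y ^ 2 = -1 := by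
    intro y hy
    have hy' : y ≠ 0 := by rintro rfl; rw [h10] at hy; exact one_ne_zero hy
    have h1 := hf' 1 y
    rw [hy, mul_zero] at h1
    have l1 := lines y hy _ _ h1
    have h2 := hf' 1 (-y)
    rw [heven, hy, mul_zero] at h2
    have l2 := lines y hy _ _ h2
    -- subtracting the two equations
    have : 4 * y * (((q : ℂ) - 1) * y ^ 2 + 1) = 0 := by linear_combination l2 - l1
    have := (mul_eq_zero.mp this).resolve_left (mul_ne_zero (by norm_num) hy')
    linear_combination this
  have h01 : f 0 1 ≠ 0 := by
    intro h
    have := lines y0 hy0 0 1 h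
    simp at this
  have hev : ∀ c ∈ S, Even (wt c) := fun c hc => even_iff_two_dvd.mpr (hdvd c hc)
  refine ⟨hcard, hev, ?_⟩
  set Q : Polynomial ℂ := ∑ c ∈ S, Polynomial.X ^ (wt c / 2) with hQdef
  have hQ : ∀ y, Q.eval (y ^ 2) = f 1 y := by
    intro y
    simp only [hQdef, hfdef, Polynomial.eval_finsetSum, Polynomial.eval_pow, Polynomial.eval_X,
      one_pow, one_mul]
    apply sum_congr rfl
    intro c hc
    rw [← pow_mul, Nat.mul_div_cancel' (hdvd c hc)]
  have hcoef : ∀ j, Q.coeff j = ({c ∈ S | wt c = 2 * j}.card : ℂ) := by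
    intro j
    rw [hQdef, Polynomial.finsetSum_coeff]
    simp only [Polynomial.coeff_X_pow]
    rw [Finset.sum_boole]
    congr 2
    apply Finset.filter_congr
    intro c hc
    have := hdvd c hc
    omega
  set z0 : ℂ := -1 / ((q : ℂ) - 1) with hz0
  have hz0ne : z0 ≠ 0 := div_ne_zero (by norm_num) hq1
  have hQroot : ∀ z ∈ Q.roots, z = z0 := by
    intro z hz
    obtain ⟨y, rfl⟩ := IsAlgClosed.exists_pow_nat_eq z (n := 2) (by norm_num)
    have hz' : Q.eval (y ^ 2) = 0 := (Polynomial.mem_roots'.mp hz).2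
    rw [hQ] at hz'
    rw [hz0, eq_div_iff hq1, mul_comm]
    exact roots y hz'
  have hnd : Q.natDegree = n := by
    apply le_antisymm
    · apply Polynomial.natDegree_sum_le_of_forall_le
      intro c hc
      rw [Polynomial.natDegree_X_pow]
      have := hle c hc
      omega
    · apply Polynomial.le_natDegree_of_ne_zero
      rw [hcoef]
      intro h
      apply h01
      rw [hfdef]
      simp only [one_pow, mul_one]
      refine Eq.trans ?_ h
      rw [← Finset.sum_boole]
      apply sum_congr rfl
      intro c hc
      have := hle c hc
      by_cases hw : wt c = 2 * n
      · simp [hw]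
      · rw [if_neg hw, zero_pow]
        omega
  have hsplit : Q.Splits := IsAlgClosed.splits Q
  have hQeq := hsplit.eq_prod_roots
  have hrep : Q.roots = Multiset.replicate n z0 := by
    rw [Multiset.eq_replicate]
    refine ⟨?_, hQroot⟩
    rw [← hnd]
    exact hsplit.natDegree_eq_card_roots.symm
  rw [hrep, Multiset.map_replicate, Multiset.prod_replicate] at hQeq
  have hQ0 : Q.eval 0 = 1 := by
    have := hQ 0
    rwa [zero_pow two_ne_zero, h10] at this
  have hc1 : Q.coeff 1 = Q.derivative.eval 0 := by
    rw [← Polynomial.coeff_zero_eq_eval_zero, Polynomial.coeff_derivative]; simp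
  have hder : Q.derivative.eval 0 = n * ((q : ℂ) - 1) := by
    obtain ⟨m, rfl⟩ : ∃ m, n = m + 1 := ⟨n - 1, by omega⟩
    generalize Q.leadingCoeff = a at hQeq
    rw [hQeq] at hQ0 ⊢
    simp [Polynomial.derivative_pow] at hQ0 ⊢
    have : z0 * ((q : ℂ) - 1) = -1 := by rw [hz0]; field_simp
    clear_value z0
    linear_combination ((m + 1) * a * (-z0) ^ m) * this + (m + 1) * ((q : ℂ) - 1) * hQ0
  have h1 := hcoef 1
  rw [hc1, hder, mul_one] at h1
  have : ((n * (q - 1) : ℕ) : ℂ) = ({c ∈ S | wt c = 2}.card : ℂ) := by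
    rw [← h1, Nat.cast_mul, Nat.cast_sub (by omega)]; simp
  exact_mod_cast this.symm

lemma pair_of_weight_two {F : Type*} [Field F] [Fintype F] [DecidableEq F] {n : ℕ}
    (hq : 4 < Fintype.card F) (C : Submodule F (Fin (2 * n) → F))
    (hcard : Nat.card C = Fintype.card F ^ n)
    (heven : ∀ c ∈ C, Even (hammingNorm c))
    (T : Finset (Fin (2 * n) → F)) (hT : ∀ c, c ∈ T ↔ c ∈ C ∧ hammingNorm c = 2)
    (hTcard : T.card = n * (Fintype.card F - 1)) :
    MonomialEquiv C (pairCode F (2 * n)) := by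
  classical
  set supp : (Fin (2 * n) → F) → Finset (Fin (2 * n)) := fun c => {i | c i ≠ 0} with hsupp
  have hnorm : ∀ c, hammingNorm c = (supp c).card := fun c => rfl
  have hmem : ∀ c i, i ∈ supp c ↔ c i ≠ 0 := by intro c i; simp [hsupp]
  -- fibres of the support map
  have hfib : ∀ s ∈ T.image supp, #{x ∈ T | supp x = s} ≤ Fintype.card F - 1 := by
    intro s hs
    obtain ⟨c, hc, rfl⟩ := mem_image.mp hs
    have h2 : (supp c).card = 2 := ((hT c).mp hc).2
    obtain ⟨i, j, hij, hsij⟩ := Finset.card_eq_two.mp h2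
    have : Fintype.card F - 1 = (univ.erase (0 : F)).card := by
      rw [card_erase_of_mem (mem_univ _), card_univ]
    rw [this]
    apply Finset.card_le_card_of_injOn (fun x => x i)
    · intro x hx
      simp only [coe_filter, Set.mem_ofPred_eq] at hx
      have : i ∈ supp x := by rw [hx.2, hsij]; simp
      simpa using (hmem _ _).mp this
    · intro x hx y hy hxy
      simp only [coe_filter, Set.mem_ofPred_eq] at hx hy
      simp only at hxy
      have hsub : x - y ∈ C := C.sub_mem ((hT x).mp hx.1).1 ((hT y).mp hy.1).1
      have hs : supp (x - y) ⊆ {j} := by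
        intro k hk
        rw [hmem, Pi.sub_apply] at hk
        by_contra hkj
        rw [mem_singleton] at hkj
        apply hk
        by_cases hki : k = i
        · rw [hki, hxy, sub_self]
        · have hx0 : k ∉ supp x := by rw [hx.2, hsij]; simp [hki, hkj]
          have hy0 : k ∉ supp y := by rw [hy.2, hsij]; simp [hki, hkj]
          rw [hmem, not_not] at hx0 hy0
          rw [hx0, hy0, sub_self]
      have hle := card_le_card hs
      rw [card_singleton, ← hnorm] at hle
      obtain ⟨r, hr⟩ := heven _ hsub
      have : hammingNorm (x - y) = 0 := by omega
      exact sub_eq_zero.mp (hammingNorm_eq_zero.mp this)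
  have hcount := Finset.card_le_mul_card_image T _ hfib
  have hn : n ≤ (T.image supp).card := by
    rw [hTcard, mul_comm n] at hcount
    exact Nat.le_of_mul_le_mul_left hcount (by omega)
  -- disjointness
  have hdisj : ∀ s ∈ T.image supp, ∀ t ∈ T.image supp, ∀ i, i ∈ s → i ∈ t → s = t := by
    intro s hs t ht i his hit
    obtain ⟨c, hc, rfl⟩ := mem_image.mp hs
    obtain ⟨d, hd, rfl⟩ := mem_image.mp ht
    have hc2 : (supp c).card = 2 := ((hT c).mp hc).2
    have hd2 : (supp d).card = 2 := ((hT d).mp hd).2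
    by_contra hne
    have hci := (hmem _ _).mp his
    have hdi := (hmem _ _).mp hit
    obtain ⟨l, hl⟩ : ∃ l : F, l ∉ ({0, - (c i / d i)} : Finset F) := by
      by_contra hall
      push Not at hall
      have h1 : (univ : Finset F) ⊆ {0, - (c i / d i)} := fun l _ => hall l
      have h2 := card_le_card h1
      have h3 := Finset.card_le_two (a := (0 : F)) (b := - (c i / d i))
      rw [card_univ] at h2
      omega
    simp only [mem_insert, mem_singleton, not_or] at hl
    have hmemC : c + l • d ∈ C := C.add_mem ((hT c).mp hc).1 (C.smul_mem _ ((hT d).mp hd).1)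
    have hinter : supp c ∩ supp d = {i} := by
      symm
      apply Finset.eq_of_subset_of_card_le
      · intro k hk
        rw [mem_singleton.mp hk]
        exact mem_inter.mpr ⟨his, hit⟩
      · rw [card_singleton]
        by_contra hlt
        push Not at hlt
        have e1 : supp c ∩ supp d = supp c :=
          Finset.eq_of_subset_of_card_le inter_subset_left (by omega)
        have e2 : supp c ∩ supp d = supp d :=
          Finset.eq_of_subset_of_card_le inter_subset_right (by omega)
        exact hne (e1.symm.trans e2)
    have hs : supp (c + l • d) = supp c ∪ supp d := by
      ext k
      rw [mem_union, hmem, Pi.add_apply, Pi.smul_apply, smul_eq_mul]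
      by_cases hki : k = i
      · subst hki
        refine ⟨fun _ => Or.inl his, fun _ h => hl.2 ?_⟩
        field_simp
        linear_combination h
      · have hk : ¬ (k ∈ supp c ∧ k ∈ supp d) := by
          rw [← mem_inter, hinter, mem_singleton]; exact hki
        rw [hmem, hmem] at hk ⊢
        by_cases h1 : c k = 0
        · simp [h1, hl.1]
        · have h2 : d k = 0 := by
            by_contra h2; exact hk ⟨h1, h2⟩
          simp [h1, h2]
    have hcu := Finset.card_union_add_card_inter (supp c) (supp d)
    rw [hinter, card_singleton, ← hs, ← hnorm] at hcu
    obtain ⟨r, hr⟩ := heven _ hmemC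
    omega
  -- choose n words
  obtain ⟨U, hU, hUc⟩ := Finset.exists_subset_card_eq hn
  let e : Fin n ≃ U := (Finset.equivFinOfCardEq hUc).symm
  have hex : ∀ k : Fin n, ∃ c ∈ C, ∃ i j, i ≠ j ∧ supp c = (e k : Finset (Fin (2 * n))) ∧
      supp c = {i, j} := by
    intro k
    obtain ⟨c, hc, hck⟩ := mem_image.mp (hU (e k).2)
    obtain ⟨i, j, hij, hsij⟩ := Finset.card_eq_two.mp (show (supp c).card = 2 from ((hT c).mp hc).2)
    exact ⟨c, ((hT c).mp hc).1, i, j, hij, hck, hsij⟩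
  choose g hgC p r hpr hge hgs using hex
  have hek : ∀ k l i, i ∈ supp (g k) → i ∈ supp (g l) → k = l := by
    intro k l i hk hl
    rw [hge] at hk hl
    have := hdisj _ (hU (e k).2) _ (hU (e l).2) i hk hl
    exact e.injective (Subtype.ext this)
  have hpm : ∀ k, p k ∈ supp (g k) := by intro k; rw [hgs]; simp
  have hrm : ∀ k, r k ∈ supp (g k) := by intro k; rw [hgs]; simp
  let half : Fin (2 * n) → Fin n := fun i => ⟨i / 2, by omega⟩
  let φ : Fin (2 * n) → Fin (2 * n) := fun i => if (i : ℕ) % 2 = 0 then p (half i) else r (half i)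
  have hφm : ∀ i, φ i ∈ supp (g (half i)) := by
    intro i
    simp only [φ]
    split_ifs
    · exact hpm _
    · exact hrm _
  have hφinj : Function.Injective φ := by
    intro a b hab
    have hh : half a = half b := hek _ _ (φ a) (hφm a) (by rw [hab]; exact hφm b)
    have hv : (a : ℕ) / 2 = b / 2 := congrArg Fin.val hh
    simp only [φ, hh] at hab
    apply Fin.ext
    split_ifs at hab with h1 h2 h2
    · omega
    · exact absurd hab (hpr _)
    · exact absurd hab.symm (hpr _)
    · omega
  let π : Equiv.Perm (Fin (2 * n)) := Equiv.ofBijective φ (Finite.injective_iff_bijective.mp hφinj)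
  have hπ : ∀ i, π i = φ i := fun i => rfl
  have hne : ∀ i, g (half i) (φ i) ≠ 0 := fun i => (hmem _ _).mp (hφm i)
  refine ⟨fun i => (Units.mk0 _ (hne i))⁻¹, π, ?_⟩
  refine Set.eq_of_subset_of_ncard_le ?_ ?_ (Set.toFinite _)
  · intro w hw
    refine ⟨∑ k : Fin n, w ⟨2 * (k : ℕ), by omega⟩ • g k, C.sum_mem fun k _ => C.smul_mem _ (hgC k), ?_⟩
    ext i
    simp only [hπ, Finset.sum_apply, Pi.smul_apply, smul_eq_mul]
    rw [Finset.sum_eq_single (half i)]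
    · have : w ⟨2 * (half i : ℕ), by omega⟩ = w i := by
        rcases Nat.mod_two_eq_zero_or_one (i : ℕ) with h | h
        · congr 1
          apply Fin.ext
          simp only [half]
          omega
        · have hw' := hw (half i : ℕ) (by omega) (by omega)
          rw [hw']
          congr 1
          apply Fin.ext
          simp only [half]
          omega
      rw [this, Units.val_inv_eq_inv_val, Units.val_mk0]
      have := hne i
      field_simp
    · intro k _ hk
      have : g k (φ i) = 0 := by
        by_contra h
        exact hk (hek k (half i) (φ i) ((hmem _ _).mpr h) (hφm i))
      rw [this, mul_zero]
    · intro h; exact absurd (mem_univ _) h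
  · have h1 : Set.ncard (C : Set (Fin (2 * n) → F)) = Fintype.card F ^ n := by
      rw [← hcard]; rfl
    refine (Set.ncard_image_le (Set.toFinite _)).trans ?_
    rw [h1]
    have h2 : Fintype.card F ^ n = (Set.univ : Set (Fin n → F)).ncard := by
      rw [Set.ncard_univ, Nat.card_eq_fintype_card]; simp
    rw [h2]
    apply Set.ncard_le_ncard_of_injOn (fun v i => v (half i))
    · intro v _ j h1 h2
      simp only [half]
      congr 1
      apply Fin.ext
      simp only
      omega
    · intro v _ w _ hvw
      ext k
      have := congrFun hvw ⟨2 * k, by omega⟩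
      simp only [half] at this
      have hk : (⟨2 * (k : ℕ) / 2, by omega⟩ : Fin n) = k := by
        apply Fin.ext; simp
      rwa [hk] at this

lemma eval_homWeightEnum {F : Type*} [Field F] [Fintype F]
    [DecidableEq F] {ι : Type*} [Fintype ι] (C : Submodule F (ι → F)) (v : Fin 2 → ℂ) :
    MvPolynomial.eval v (homWeightEnum ℂ C) =
      ∑ c ∈ (Set.toFinite (C : Set (ι → F))).toFinset,
        v 0 ^ (Fintype.card ι - hammingNorm c) * v 1 ^ hammingNorm c := by
  simp [homWeightEnum]

lemma eval_matAct (A : Matrix (Fin 2) (Fin 2) ℂ) (p : MvPolynomial (Fin 2) ℂ) (v : Fin 2 → ℂ) :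
    MvPolynomial.eval v (matAct A p) =
      MvPolynomial.eval (fun i => A i 0 * v 0 + A i 1 * v 1) p := by
  unfold matAct
  induction p using MvPolynomial.induction_on with
  | C a => simp
  | add p q hp hq => simp only [map_add, hp, hq]
  | mul_X p i hp =>
    rw [map_mul, map_mul, hp, map_mul, MvPolynomial.aeval_X]
    simp

theorem formally_self_dual_divisible_classification {F : Type*} [Field F] [Fintype F]
    [DecidableEq F] {n : ℕ}
    (hq : 4 < Fintype.card F)
    (C : Submodule F (Fin (2 * n) → F))
    (hfsd : homWeightEnum ℂ C =
      (Nat.card C : ℂ)⁻¹ •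
        matAct ![![1, (Fintype.card F : ℂ) - 1], ![1, -1]] (homWeightEnum ℂ C))
    (hdiv : ∃ Δ : ℕ, 1 < Δ ∧ ∀ c ∈ C, Δ ∣ hammingNorm c) :
    MonomialEquiv C (pairCode F (2 * n)) := by
  classical
  rcases Nat.eq_zero_or_pos n with hn | hn
  · subst hn
    refine ⟨fun _ => 1, 1, ?_⟩
    have : Subsingleton (Fin (2 * 0) → F) := ⟨fun a b => funext fun i => i.elim0⟩
    have h1 : (pairCode F (2 * 0) : Set (Fin (2 * 0) → F)) = Set.univ :=
      Set.eq_univ_of_forall fun v => by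
        rw [Subsingleton.elim v 0]; exact (pairCode F (2 * 0)).zero_mem
    rw [h1]
    symm
    apply Set.eq_univ_of_forall
    intro v
    exact ⟨0, C.zero_mem, Subsingleton.elim _ _⟩
  obtain ⟨D, hD, hdvd⟩ := hdiv
  set S := (Set.toFinite (C : Set (Fin (2 * n) → F))).toFinset with hS
  have hmS : ∀ c, c ∈ S ↔ c ∈ C := by intro c; simp [hS]
  have hcardS : Nat.card C = S.card := by
    have := Set.ncard_eq_toFinset_card (C : Set (Fin (2 * n) → F)) (Set.toFinite _)
    rw [← this]; rfl
  have hS0 : (S.card : ℂ) ≠ 0 := by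
    have : S.card ≠ 0 := Finset.card_ne_zero_of_mem ((hmS 0).mpr C.zero_mem)
    exact_mod_cast this
  obtain ⟨h1, h2, h3⟩ := weight_two_count S hammingNorm n (Fintype.card F) D hn hq hD
    (fun c _ => by simpa using hammingNorm_le_card_fintype (x := c))
    (fun c hc => hdvd c ((hmS c).mp hc))
    (by
      rw [Finset.sum_eq_single 0]
      · simp
      · intro c _ hc
        rw [zero_pow (by simpa using hc), mul_zero]
      · intro h; exact absurd ((hmS 0).mpr C.zero_mem) h)
    (by
      intro x y
      have := congrArg (MvPolynomial.eval ![x, y]) hfsd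
      rw [MvPolynomial.smul_eval] at this
      replace this := this.trans (congrArg (fun t => (Nat.card C : ℂ)⁻¹ * t) (eval_matAct _ _ _))
      rw [eval_homWeightEnum, eval_homWeightEnum, hcardS,
        ← hS] at this
      simp only [Fintype.card_fin] at this
      simp at this
      rw [this, mul_inv_cancel_left₀ hS0]
      simp [sub_eq_add_neg])
  refine pair_of_weight_two hq C (hcardS.trans h1) (fun c hc => h2 c ((hmS c).mpr hc))
    {c ∈ S | hammingNorm c = 2} ?_ h3
  intro c
  rw [mem_filter, hmS]
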